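/- Let n1 ≥ 5 be odd, n2 ≥ 1, n3 ≥ 2 and ℓ ≥ 1. Then the graph L^ℓ_{n1,n2,n3} satisfies dim(L^ℓ_{n1,n2,n3}) = n3 and edim(L^ℓ_{n1,n2,n3}) = n3 + ℓ. -/

import Mathlib

/-- `S` is a metric generator of `G`: every pair of distinct vertices is
identified by some vertex of `S` via distances. -/
def IsMetricGenerator {V : Type*} (G : SimpleGraph V) (S : Set V) : Prop :=
  ∀ u v : V, u ≠ v → ∃ z ∈ S, G.dist u z ≠ G.dist v z

/-- The metric dimension of `G`: the least cardinality of a (finite) metric generator. -/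
noncomputable def metricDim {V : Type*} (G : SimpleGraph V) : ℕ :=
  sInf {n | ∃ S : Set V, S.Finite ∧ IsMetricGenerator G S ∧ S.ncard = n}

/-- Distance from an edge (unordered pair) to a vertex:
`d(uv, z) = min (d u z) (d v z)`. -/
noncomputable def edgeDist {V : Type*} (G : SimpleGraph V) (e : Sym2 V) (z : V) : ℕ :=
  Sym2.lift ⟨fun u v => min (G.dist u z) (G.dist v z), fun u v => by simp [min_comm]⟩ e

/-- `S` is an edge metric generator of `G`: every pair of distinct edges is
distinguished by some vertex of `S`. -/
def IsEdgeMetricGenerator {V : Type*} (G : SimpleGraph V) (S : Set V) : Prop :=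
  ∀ e ∈ G.edgeSet, ∀ f ∈ G.edgeSet, e ≠ f → ∃ z ∈ S, edgeDist G e z ≠ edgeDist G f z

/-- The edge metric dimension of `G`: the least cardinality of a (finite) edge
metric generator. -/
noncomputable def edgeMetricDim {V : Type*} (G : SimpleGraph V) : ℕ :=
  sInf {n | ∃ S : Set V, S.Finite ∧ IsEdgeMetricGenerator G S ∧ S.ncard = n}
/-- Vertices of the graph `G_{n1,n2,n3}`: cycle vertices `a 0, …, a (n1-1)`
(with `a k` standing for the paper's `a_{k+1}`), path vertices
`b 0, …, b (n2-1)`, the special vertices `c` and `i`, and pendant vertices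
`j 0, …, j (n3-1)` attached to `i`. -/
inductive GVert (n1 n2 n3 : ℕ) : Type where
  | a : Fin n1 → GVert n1 n2 n3
  | b : Fin n2 → GVert n1 n2 n3
  | c : GVert n1 n2 n3
  | i : GVert n1 n2 n3
  | j : Fin n3 → GVert n1 n2 n3

/-- Base relation whose symmetrization gives the edges of `G_{n1,n2,n3}`:
the cycle `a_1 a_2 ⋯ a_{n1} a_1`, the path `b_1 b_2 ⋯ b_{n2}` joined by the
edge `a_2 b_1`, the edge `a_{n1} c`, the edge `a_1 i`, and the pendant edges
`i j_t`. -/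
def GRel (n1 n2 n3 : ℕ) : GVert n1 n2 n3 → GVert n1 n2 n3 → Prop
  | .a k, .a l => (l : ℕ) = ((k : ℕ) + 1) % n1
  | .a k, .b m => (k : ℕ) = 1 ∧ (m : ℕ) = 0
  | .b m, .b m' => (m' : ℕ) = (m : ℕ) + 1
  | .a k, .c => (k : ℕ) = n1 - 1
  | .a k, .i => (k : ℕ) = 0
  | .i, .j _ => True
  | _, _ => False

/-- The graph `G_{n1,n2,n3}` from the paper. -/
def GGraph (n1 n2 n3 : ℕ) : SimpleGraph (GVert n1 n2 n3) :=
  SimpleGraph.fromRel (GRel n1 n2 n3)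
/-- `x` is the vertex `a_α` of `G_{n1,n2,n3}`, where `α = ⌊(n1+1)/2⌋`
(recall `a k` stands for `a_{k+1}`). -/
def IsAlphaVert {n1 n2 n3 : ℕ} : GVert n1 n2 n3 → Prop
  | .a p => (p : ℕ) = (n1 + 1) / 2 - 1
  | _ => False

/-- `x` is the vertex `j_1` of `G_{n1,n2,n3}`. -/
def IsJOneVert {n1 n2 n3 : ℕ} : GVert n1 n2 n3 → Prop
  | .j q => (q : ℕ) = 0
  | _ => False

/-- Vertices of `L^ℓ_{n1,n2,n3}`: the first copy `G_1 = G_{n1,n2,n3}` (the `inl`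
part) together with `ℓ - 1` further copies `G_2 = ⋯ = G_ℓ = G_{n1,1,2}`
(the `inr` part, copy `G_{k+2}` being indexed by `k : Fin (ℓ-1)`). -/
abbrev LVert (n1 n2 n3 ℓ : ℕ) : Type :=
  GVert n1 n2 n3 ⊕ (Fin (ℓ - 1) × GVert n1 1 2)

/-- Base relation whose symmetrization gives the edges of `L^ℓ_{n1,n2,n3}`:
the edges inside each copy, together with the connecting edges
`a_α^k j_1^{k+1}` for `k = 1, …, ℓ-1`. -/
def LRel (n1 n2 n3 ℓ : ℕ) : LVert n1 n2 n3 ℓ → LVert n1 n2 n3 ℓ → Prop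
  | .inl x, .inl y => (GGraph n1 n2 n3).Adj x y
  | .inl x, .inr (k, y) => (k : ℕ) = 0 ∧ IsAlphaVert x ∧ IsJOneVert y
  | .inr (k, x), .inr (k', y) =>
      (k = k' ∧ (GGraph n1 1 2).Adj x y) ∨
        ((k' : ℕ) = (k : ℕ) + 1 ∧ IsAlphaVert x ∧ IsJOneVert y)
  | _, _ => False

/-- The graph `L^ℓ_{n1,n2,n3}` from the paper. -/
def LGraph (n1 n2 n3 ℓ : ℕ) : SimpleGraph (LVert n1 n2 n3 ℓ) :=
  SimpleGraph.fromRel (LRel n1 n2 n3 ℓ)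


namespace SimpleGraph

/-- A function with a unique zero `z` that changes by at most one along edges and can always be
decreased along some edge is the distance to `z`. -/
theorem reachable_and_dist_eq_of_descent {V : Type*} {G : SimpleGraph V} {z : V} {f : V → ℕ}
    (hzero : ∀ v, f v = 0 ↔ v = z) (hlip : ∀ u v, G.Adj u v → f u ≤ f v + 1)
    (hdesc : ∀ v, f v ≠ 0 → ∃ w, G.Adj v w ∧ f w + 1 = f v) (v : V) :
    G.Reachable v z ∧ G.dist v z = f v := by
  have hwalk : ∀ n v, f v = n → ∃ p : G.Walk v z, p.length = n := by
    intro n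
    induction n with
    | zero =>
      intro v hv
      obtain rfl := (hzero v).1 hv
      exact ⟨.nil, rfl⟩
    | succ n ih =>
      intro v hv
      obtain ⟨w, hvw, hw⟩ := hdesc v (by omega)
      obtain ⟨p, hp⟩ := ih w (by omega)
      exact ⟨.cons hvw p, by simp [hp]⟩
  have hle : ∀ u w (p : G.Walk u w), f u ≤ f w + p.length := by
    intro u w p
    induction p with
    | nil => simp
    | cons h p ih =>
      have := hlip _ _ h
      simp only [Walk.length_cons]
      omega
  obtain ⟨p, hp⟩ := hwalk _ v rfl
  refine ⟨p.reachable, le_antisymm (hp ▸ dist_le p) ?_⟩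
  obtain ⟨q, hq⟩ := p.reachable.exists_walk_length_eq_dist
  have := hle v z q
  have := (hzero z).2 rfl
  omega

/-- If every edge leaving `A` starts at `w`, then shortest paths leaving `A` pass through `w`. -/
theorem Connected.dist_eq_dist_add_dist_of_cut {V : Type*} {G : SimpleGraph V} (hG : G.Connected)
    {A : Set V} {w : V} (hcut : ∀ u v, G.Adj u v → u ∈ A → v ∉ A → u = w) {u z : V}
    (hu : u ∈ A) (hz : z ∉ A) : G.dist u z = G.dist u w + G.dist w z := by
  classical
  refine le_antisymm hG.dist_triangle ?_
  obtain ⟨p, hp⟩ := hG.exists_walk_length_eq_dist u z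
  obtain ⟨d, hd, hd1, hd2⟩ := p.exists_boundary_dart A hu hz
  have hw : w ∈ p.support :=
    hcut _ _ d.adj hd1 hd2 ▸ p.dart_fst_mem_support_of_mem_darts hd
  have h := congrArg Walk.length (p.take_spec hw)
  rw [Walk.length_append] at h
  have h1 := dist_le (p.takeUntil w hw)
  have h2 := dist_le (p.dropUntil w hw)
  omega

end SimpleGraph

theorem metricDim_eq_of_forall_le {V : Type*} {G : SimpleGraph V} {n : ℕ}
    (hex : ∃ S : Set V, S.Finite ∧ IsMetricGenerator G S ∧ S.ncard ≤ n)
    (hle : ∀ S : Set V, S.Finite → IsMetricGenerator G S → n ≤ S.ncard) : metricDim G = n := by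
  obtain ⟨S, hfin, hS, hn⟩ := hex
  refine le_antisymm (le_trans (Nat.sInf_le ⟨S, hfin, hS, rfl⟩) hn) ?_
  refine le_csInf ⟨_, S, hfin, hS, rfl⟩ ?_
  rintro _ ⟨T, hTfin, hT, rfl⟩
  exact hle T hTfin hT

theorem edgeMetricDim_eq_of_forall_le {V : Type*} {G : SimpleGraph V} {n : ℕ}
    (hex : ∃ S : Set V, S.Finite ∧ IsEdgeMetricGenerator G S ∧ S.ncard ≤ n)
    (hle : ∀ S : Set V, S.Finite → IsEdgeMetricGenerator G S → n ≤ S.ncard) :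
    edgeMetricDim G = n := by
  obtain ⟨S, hfin, hS, hn⟩ := hex
  refine le_antisymm (le_trans (Nat.sInf_le ⟨S, hfin, hS, rfl⟩) hn) ?_
  refine le_csInf ⟨_, S, hfin, hS, rfl⟩ ?_
  rintro _ ⟨T, hTfin, hT, rfl⟩
  exact hle T hTfin hT

theorem edgeDist_mk {V : Type*} (G : SimpleGraph V) (u v z : V) :
    edgeDist G s(u, v) z = min (G.dist u z) (G.dist v z) := rfl

theorem edgeDist_eq_zero_iff {V : Type*} {G : SimpleGraph V} (hG : G.Connected) {e : Sym2 V}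
    {z : V} : edgeDist G e z = 0 ↔ z ∈ e := by
  induction e with
  | h u v =>
    have hmin : ∀ a b : ℕ, min a b = 0 ↔ a = 0 ∨ b = 0 := by omega
    rw [edgeDist_mk, hmin, hG.dist_eq_zero_iff, hG.dist_eq_zero_iff, Sym2.mem_iff,
      eq_comm, @eq_comm _ v]

/-- Positions inside one copy of `G_{n1,n2,n3}`, with unbounded indices. -/
inductive Loc : Type where
  | a (t : ℕ) : Loc
  | b (s : ℕ) : Loc
  | c : Loc
  | i : Loc
  | j (t : ℕ) : Loc

/-- The places on the cycle, on the path, and `c`. -/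
def Loc.IsCore : Loc → Prop
  | .a _ => True
  | .b _ => True
  | .c => True
  | .i => False
  | .j _ => False

/-- The positions `(k, x)` (copy `k`, place `x`) occupied by vertices of `L^{L+1}_{2m+1,n2,n3}`. -/
def ValidPos (m n2 n3 L : ℕ) : ℕ × Loc → Prop
  | (k, .a t) => k ≤ L ∧ t ≤ 2 * m
  | (k, .b s) => k ≤ L ∧ (k = 0 ∧ s < n2 ∨ k ≠ 0 ∧ s < 1)
  | (k, .c) => k ≤ L
  | (k, .i) => k ≤ L
  | (k, .j t) => k ≤ L ∧ (k = 0 ∧ t < n3 ∨ k ≠ 0 ∧ t < 2)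

/-- The oriented edges between positions. -/
inductive PosLink (m : ℕ) (p q : ℕ × Loc) : Prop where
  | cycle (k t : ℕ) (hp : p = (k, .a t)) (hq : q = (k, .a (t + 1)))
  | closing (k : ℕ) (hp : p = (k, .a (2 * m))) (hq : q = (k, .a 0))
  | toPath (k : ℕ) (hp : p = (k, .a 1)) (hq : q = (k, .b 0))
  | path (k s : ℕ) (hp : p = (k, .b s)) (hq : q = (k, .b (s + 1)))
  | toC (k : ℕ) (hp : p = (k, .a (2 * m))) (hq : q = (k, .c))
  | toI (k : ℕ) (hp : p = (k, .a 0)) (hq : q = (k, .i))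
  | pendant (k t : ℕ) (hp : p = (k, .i)) (hq : q = (k, .j t))
  | bridge (k : ℕ) (hp : p = (k, .a m)) (hq : q = (k + 1, .j 0))

/-- `LinkDist m p q r s` lists the links from `p` to `q`, where, up to terms depending only on the
copy, `r` is one plus the distance to `a_m` in the last copy and `s` is the distance to `j_0` in the
first copy. -/
inductive LinkDist (m : ℕ) (p q : ℕ × Loc) (r s : ℕ) : Prop where
  | up (k t : ℕ) (hp : p = (k, .a t)) (hq : q = (k, .a (t + 1))) (ht : t < m)
    (hr : r + t = m) (hs : s = t + 2)
  | down (k t : ℕ) (hp : p = (k, .a t)) (hq : q = (k, .a (t + 1))) (ht : m ≤ t)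
    (hr : r + m = t + 1) (hs : s + t = 2 * m + 2)
  | closing (k : ℕ) (hp : p = (k, .a (2 * m))) (hq : q = (k, .a 0)) (hr : r = m + 1) (hs : s = 2)
  | toPath (k : ℕ) (hp : p = (k, .a 1)) (hq : q = (k, .b 0)) (hr : r = m) (hs : s = 3)
  | path (k t : ℕ) (hp : p = (k, .b t)) (hq : q = (k, .b (t + 1))) (hk : k = 0)
    (hr : r = t + m + 1) (hs : s = t + 4)
  | toC (k : ℕ) (hp : p = (k, .a (2 * m))) (hq : q = (k, .c)) (hr : r = m + 1) (hs : s = 3)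
  | toI (k : ℕ) (hp : p = (k, .a 0)) (hq : q = (k, .i)) (hr : r = m + 1) (hs : s = 1)
  | pendantZero (k : ℕ) (hp : p = (k, .i)) (hq : q = (k, .j 0)) (hr : r = m + 2) (hs : s = 0)
  | pendantSucc (k t : ℕ) (hp : p = (k, .i)) (hq : q = (k, .j (t + 1))) (hr : r = m + 2)
    (hs : s = 1)
  | bridge (k : ℕ) (hp : p = (k, .a m)) (hq : q = (k + 1, .j 0)) (hr : r = 0) (hs : s = m + 2)

/-- Coordinates identifying `G` with the graph `L^{L+1}_{2m+1,n2,n3}`. -/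
structure LCoordinates {V : Type*} (G : SimpleGraph V) (m n2 n3 L : ℕ) where
  pos : V → ℕ × Loc
  injective : Function.Injective pos
  valid : ∀ v, ValidPos m n2 n3 L (pos v)
  surj : ∀ p, ValidPos m n2 n3 L p → ∃ v, pos v = p
  adj_iff : ∀ u v, G.Adj u v ↔ PosLink m (pos u) (pos v) ∨ PosLink m (pos v) (pos u)

/-- The distance between `a_s` and `a_t` on a cycle of length `2m+1`. -/
def cycleDist (m s t : ℕ) : ℕ := min ((s - t) + (t - s)) (2 * m + 1 - ((s - t) + (t - s)))

/-- The distance to `a_t` inside one copy. -/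
def distA (m t : ℕ) : Loc → ℕ
  | .a s => cycleDist m s t
  | .b s => s + 1 + cycleDist m 1 t
  | .c => 1 + cycleDist m (2 * m) t
  | .i => 1 + cycleDist m 0 t
  | .j _ => 2 + cycleDist m 0 t

/-- The distance to `j_0` inside one copy. -/
def distJ (m : ℕ) : Loc → ℕ
  | .a s => cycleDist m s 0 + 2
  | .b s => s + 4
  | .c => 4
  | .i => 1
  | .j 0 => 0
  | .j (_ + 1) => 2

/-- The distance to `a_t` in the last copy. -/
def distLastA (m L t : ℕ) (p : ℕ × Loc) : ℕ :=
  if p.1 = L then distA m t p.2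
  else distA m m p.2 + (L - (p.1 + 1)) * (m + 3) + (3 + cycleDist m 0 t)

/-- The distance to `j_0` in the first copy. -/
def distFirstJ (m : ℕ) (p : ℕ × Loc) : ℕ := distJ m p.2 + p.1 * (m + 3)

theorem distLastA_mid {m L k : ℕ} (hk : k ≤ L) (x : Loc) :
    distLastA m L m (k, x) = distA m m x + (L - k) * (m + 3) := by
  unfold distLastA
  split_ifs with h
  · simp only at h
    simp [h]
  · obtain ⟨d, rfl⟩ : ∃ d, L = k + 1 + d := ⟨L - (k + 1), by simp only at h; omega⟩
    have h1 : k + 1 + d - (k + 1) = d := by omega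
    have h2 : k + 1 + d - k = d + 1 := by omega
    simp only [h1, h2, cycleDist, add_mul]
    omega

namespace LCoordinates

variable {V : Type*} {G : SimpleGraph V} {m n2 n3 L : ℕ}

theorem exists_distA_descent (hm : 2 ≤ m) {k t : ℕ} (ht : t ≤ 2 * m) {x : Loc}
    (hx : ValidPos m n2 n3 L (k, x)) (h0 : distA m t x ≠ 0) :
    ∃ y, ValidPos m n2 n3 L (k, y) ∧ (PosLink m (k, x) (k, y) ∨ PosLink m (k, y) (k, x)) ∧
      distA m t y + 1 = distA m t x := by
  cases x with
  | a s =>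
    simp only [ValidPos, distA, cycleDist] at hx h0
    have hup : s < 2 * m → PosLink m (k, .a s) (k, .a (s + 1)) := fun _ => .cycle k s rfl rfl
    have hdown : s ≠ 0 → PosLink m (k, .a (s - 1)) (k, .a s) :=
      fun h => .cycle k (s - 1) rfl (by rw [Nat.sub_add_cancel (by omega)])
    by_cases hs : (s < t ∧ t - s ≤ m) ∨ (t < s ∧ m < s - t)
    · by_cases hs2 : s = 2 * m
      · refine ⟨.a 0, ⟨hx.1, by omega⟩, .inl (.closing k (by rw [hs2]) rfl), ?_⟩
        simp only [distA, cycleDist]; omega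
      · refine ⟨.a (s + 1), ⟨hx.1, by omega⟩, .inl (hup (by omega)), ?_⟩
        simp only [distA, cycleDist]; omega
    · by_cases hs2 : s = 0
      · refine ⟨.a (2 * m), ⟨hx.1, by omega⟩, .inr (.closing k rfl (by rw [hs2])), ?_⟩
        simp only [distA, cycleDist]; omega
      · refine ⟨.a (s - 1), ⟨hx.1, by omega⟩, .inr (hdown hs2), ?_⟩
        simp only [distA, cycleDist]; omega
  | b s =>
    simp only [ValidPos] at hx
    cases s with
    | zero =>
      refine ⟨.a 1, ⟨hx.1, by omega⟩, .inr (.toPath k rfl rfl), ?_⟩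
      simp only [distA, cycleDist]; omega
    | succ s =>
      refine ⟨.b s, ⟨hx.1, by omega⟩, .inr (.path k s rfl rfl), ?_⟩
      simp only [distA, cycleDist]; omega
  | c =>
    exact ⟨.a (2 * m), ⟨hx, le_rfl⟩, .inr (.toC k rfl rfl), by simp only [distA]; omega⟩
  | i =>
    exact ⟨.a 0, ⟨hx, by omega⟩, .inr (.toI k rfl rfl), by simp only [distA]; omega⟩
  | j t' =>
    exact ⟨.i, hx.1, .inr (.pendant k t' rfl rfl), by simp only [distA]; omega⟩

theorem distLastA_add_one_of_bridge {k t : ℕ} (hk : k + 1 ≤ L) :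
    distLastA m L t (k + 1, .j 0) + 1 = distLastA m L t (k, .a m) := by
  unfold distLastA
  obtain ⟨d, rfl⟩ : ∃ d, L = k + 1 + d := ⟨L - (k + 1), by omega⟩
  have h1 : k + 1 + d - (k + 1) = d := by omega
  cases d with
  | zero => simp [distA, cycleDist]; omega
  | succ d =>
    have h2 : k + 1 + (d + 1) - (k + 1 + 1) = d := by omega
    rw [if_neg (by simp), if_neg (by simp; omega)]
    simp only [h1, h2, distA, cycleDist, add_mul]
    omega

/-- The distance to `a_t` in the last copy changes by at most one along a link. -/
theorem distLastA_lipschitz (hm : 2 ≤ m) {t : ℕ} (ht : t ≤ 2 * m) {p q : ℕ × Loc}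
    (hp : ValidPos m n2 n3 L p) (hq : ValidPos m n2 n3 L q) (h : PosLink m p q) :
    distLastA m L t p ≤ distLastA m L t q + 1 ∧ distLastA m L t q ≤ distLastA m L t p + 1 := by
  have hlocal : ∀ k x y, p = (k, x) → q = (k, y) →
      (∀ s, s ≤ 2 * m → distA m s x ≤ distA m s y + 1 ∧ distA m s y ≤ distA m s x + 1) →
      distLastA m L t p ≤ distLastA m L t q + 1 ∧ distLastA m L t q ≤ distLastA m L t p + 1 := by
    rintro k x y rfl rfl hs
    have h1 := hs t ht
    have h2 := hs m (by omega)
    unfold distLastA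
    split_ifs
    · exact h1
    · simp only; omega
  rcases h with ⟨k, s, hp', hq'⟩ | ⟨k, hp', hq'⟩ | ⟨k, hp', hq'⟩ | ⟨k, s, hp', hq'⟩ |
    ⟨k, hp', hq'⟩ | ⟨k, hp', hq'⟩ | ⟨k, s, hp', hq'⟩ | ⟨k, hp', hq'⟩
  case bridge =>
    subst hp' hq'
    have := distLastA_add_one_of_bridge (m := m) (t := t) (k := k) (L := L) hq.1
    omega
  all_goals
    refine hlocal k _ _ hp' hq' fun r hr => ?_
    subst hp' hq'
    simp only [ValidPos] at hp hq
    simp only [distA, cycleDist]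
    omega

theorem distFirstJ_lipschitz (hm : 2 ≤ m) {p q : ℕ × Loc}
    (hp : ValidPos m n2 n3 L p) (hq : ValidPos m n2 n3 L q) (h : PosLink m p q) :
    distFirstJ m p ≤ distFirstJ m q + 1 ∧ distFirstJ m q ≤ distFirstJ m p + 1 := by
  rcases h with ⟨k, s, rfl, rfl⟩ | ⟨k, rfl, rfl⟩ | ⟨k, rfl, rfl⟩ | ⟨k, s, rfl, rfl⟩ |
    ⟨k, rfl, rfl⟩ | ⟨k, rfl, rfl⟩ | ⟨k, _ | s, rfl, rfl⟩ | ⟨k, rfl, rfl⟩ <;>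
  simp only [ValidPos] at hp hq <;>
  simp only [distFirstJ, distJ, cycleDist, add_mul] <;>
  omega

/-- Distances to `a_t` in the last copy. -/
theorem reachable_and_dist_lastA (C : LCoordinates G m n2 n3 L) (hm : 2 ≤ m) {t : ℕ}
    (ht : t ≤ 2 * m) {z : V} (hz : C.pos z = (L, .a t)) (v : V) :
    G.Reachable v z ∧ G.dist v z = distLastA m L t (C.pos v) := by
  refine SimpleGraph.reachable_and_dist_eq_of_descent (f := fun v => distLastA m L t (C.pos v))
    (fun v => ?_) (fun u v h => ?_) (fun v hv => ?_) v
  · constructor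
    · intro h
      apply C.injective
      rw [hz]
      have hval := C.valid v
      generalize C.pos v = p at h hval ⊢
      obtain ⟨k, x⟩ := p
      unfold distLastA at h
      split_ifs at h with hk
      · simp only at hk h
        subst hk
        cases x <;> simp only [distA, cycleDist, ValidPos] at h hval <;> simp <;> omega
      · omega
    · rintro rfl
      simp [hz, distLastA, distA, cycleDist]
  · rcases (C.adj_iff u v).1 h with h | h
    · exact (distLastA_lipschitz hm ht (C.valid _) (C.valid _) h).1
    · exact (distLastA_lipschitz hm ht (C.valid _) (C.valid _) h).2
  · have hval := C.valid v
    suffices h : ∃ q, ValidPos m n2 n3 L q ∧ (PosLink m (C.pos v) q ∨ PosLink m q (C.pos v)) ∧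
        distLastA m L t q + 1 = distLastA m L t (C.pos v) by
      obtain ⟨q, hq, hl, hd⟩ := h
      obtain ⟨w, rfl⟩ := C.surj q hq
      exact ⟨w, (C.adj_iff v w).2 hl, hd⟩
    generalize C.pos v = p at hv hval ⊢
    obtain ⟨k, x⟩ := p
    have hkL : k ≤ L := by cases x <;> simp only [ValidPos] at hval <;> omega
    by_cases hk : k = L
    · subst hk
      obtain ⟨y, hy, hl, hd⟩ := exists_distA_descent hm ht hval (by simpa [distLastA] using hv)
      exact ⟨(k, y), hy, hl, by simpa [distLastA] using hd⟩
    · by_cases hx : distA m m x = 0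
      · obtain rfl : x = .a m := by
          cases x <;> simp only [distA, cycleDist, ValidPos] at hx hval <;> simp <;> omega
        exact ⟨(k + 1, .j 0), by simp only [ValidPos]; omega, .inl (.bridge k rfl rfl),
          distLastA_add_one_of_bridge (by omega)⟩
      · obtain ⟨y, hy, hl, hd⟩ := exists_distA_descent hm (by omega) hval hx
        refine ⟨(k, y), hy, hl, ?_⟩
        simp only [distLastA, hk, if_false]
        omega

/-- Distances to `j_0` in the first copy. -/
theorem dist_firstJ (C : LCoordinates G m n2 n3 L) (hm : 2 ≤ m) {z : V}
    (hz : C.pos z = (0, .j 0)) (v : V) : G.dist v z = distFirstJ m (C.pos v) := by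
  refine (SimpleGraph.reachable_and_dist_eq_of_descent (f := fun v => distFirstJ m (C.pos v))
    (fun v => ?_) (fun u v h => ?_) (fun v hv => ?_) v).2
  · constructor
    · intro h
      apply C.injective
      rw [hz]
      generalize C.pos v = p at h ⊢
      obtain ⟨k, x⟩ := p
      rcases x with t | s | _ | _ | _ | t <;> simp [distFirstJ, distJ] at h
      simp [h]
    · rintro rfl
      simp [hz, distFirstJ, distJ]
  · rcases (C.adj_iff u v).1 h with h | h
    · exact (distFirstJ_lipschitz hm (C.valid _) (C.valid _) h).1
    · exact (distFirstJ_lipschitz hm (C.valid _) (C.valid _) h).2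
  · have hval := C.valid v
    suffices h : ∃ q, ValidPos m n2 n3 L q ∧ (PosLink m (C.pos v) q ∨ PosLink m q (C.pos v)) ∧
        distFirstJ m q + 1 = distFirstJ m (C.pos v) by
      obtain ⟨q, hq, hl, hd⟩ := h
      obtain ⟨w, rfl⟩ := C.surj q hq
      exact ⟨w, (C.adj_iff v w).2 hl, hd⟩
    have hval_z := C.valid z
    rw [hz] at hval_z
    generalize C.pos v = p at hv hval ⊢
    obtain ⟨k, x⟩ := p
    rcases x with t | s | _ | _ | _ | t
    · by_cases ht : t = 0
      · subst ht
        exact ⟨(k, .i), hval.1, .inl (.toI k rfl rfl), by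
          simp only [distFirstJ, distJ, cycleDist]; omega⟩
      · simp only [ValidPos] at hval
        by_cases htm : t ≤ m
        · exact ⟨(k, .a (t - 1)), by simp only [ValidPos]; omega,
            .inr (.cycle k (t - 1) rfl (by rw [Nat.sub_add_cancel (by omega)])), by
              simp only [distFirstJ, distJ, cycleDist]; omega⟩
        · by_cases hlast : t = 2 * m
          · exact ⟨(k, .a 0), by simp only [ValidPos]; omega,
              .inl (.closing k (by rw [hlast]) rfl), by
                simp only [distFirstJ, distJ, cycleDist]; omega⟩
          · exact ⟨(k, .a (t + 1)), by simp only [ValidPos]; omega, .inl (.cycle k t rfl rfl), by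
              simp only [distFirstJ, distJ, cycleDist]; omega⟩
    · cases s with
      | zero =>
        exact ⟨(k, .a 1), by simp only [ValidPos] at hval ⊢; omega, .inr (.toPath k rfl rfl), by
          simp only [distFirstJ, distJ, cycleDist]; omega⟩
      | succ s =>
        exact ⟨(k, .b s), by simp only [ValidPos] at hval ⊢; omega, .inr (.path k s rfl rfl), by
          simp only [distFirstJ, distJ]; omega⟩
    · exact ⟨(k, .a (2 * m)), ⟨hval, le_rfl⟩, .inr (.toC k rfl rfl), by
        simp only [distFirstJ, distJ, cycleDist]; omega⟩
    · exact ⟨(k, .j 0), by simp only [ValidPos] at hval hval_z ⊢; omega,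
        .inl (.pendant k 0 rfl rfl), by simp only [distFirstJ, distJ]; omega⟩
    · obtain _ | k := k
      · simp [distFirstJ, distJ] at hv
      · exact ⟨(k, .a m), by simp only [ValidPos] at hval ⊢; omega, .inr (.bridge k rfl rfl), by
          simp only [distFirstJ, distJ, cycleDist, add_mul]; omega⟩
    · exact ⟨(k, .i), hval.1, .inr (.pendant k _ rfl rfl), by
        simp only [distFirstJ, distJ]; omega⟩

theorem connected (C : LCoordinates G m n2 n3 L) (hm : 2 ≤ m) : G.Connected := by
  obtain ⟨z, hz⟩ := C.surj (L, .a 0) ⟨le_rfl, by omega⟩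
  have h := fun v => (C.reachable_and_dist_lastA hm (by omega) hz v).1
  exact { preconnected := fun u v => (h u).trans (h v).symm, nonempty := ⟨z⟩ }

theorem le_of_validPos {k : ℕ} {x : Loc} (h : ValidPos m n2 n3 L (k, x)) : k ≤ L := by
  cases x <;> simp only [ValidPos] at h <;> omega

theorem mul_succ_le_of_lt {k k' M : ℕ} (hk' : k' ≤ L) (h : k < k') :
    (L - k') * M + M ≤ (L - k) * M := by
  rw [← Nat.succ_mul]
  exact Nat.mul_le_mul_right _ (by omega)

theorem distA_mid_lt {k : ℕ} {x : Loc} (hm : 2 ≤ m) (hk : k ≠ 0)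
    (h : ValidPos m n2 n3 L (k, x)) : distA m m x < m + 3 := by
  cases x <;> simp only [ValidPos] at h <;> simp only [distA, cycleDist] <;> omega

/-- Outside the leaves `j_0, …, j_{n3-2}` of the first copy, the distances to `a_m` in the last copy
and to `j_0` in the first copy determine the position. -/
theorem pos_eq_of_dist_eq (hm : 2 ≤ m) {p q : ℕ × Loc}
    (hp : ValidPos m n2 n3 L p) (hq : ValidPos m n2 n3 L q)
    (hpj : ∀ t, t + 1 < n3 → p ≠ (0, .j t)) (hqj : ∀ t, t + 1 < n3 → q ≠ (0, .j t))
    (hA : distLastA m L m p = distLastA m L m q) (hJ : distFirstJ m p = distFirstJ m q) :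
    p = q := by
  obtain ⟨k, x⟩ := p
  obtain ⟨k', y⟩ := q
  rw [distLastA_mid (le_of_validPos hp), distLastA_mid (le_of_validPos hq)] at hA
  obtain rfl : k = k' := by
    rcases lt_trichotomy k k' with h | h | h
    · have := mul_succ_le_of_lt (M := m + 3) (le_of_validPos hq) h
      have := distA_mid_lt hm (by omega) hq
      omega
    · exact h
    · have := mul_succ_le_of_lt (M := m + 3) (le_of_validPos hp) h
      have := distA_mid_lt hm (by omega) hp
      omega
  simp only [distFirstJ] at hJ
  have hA : distA m m x = distA m m y := by omega
  have hJ : distJ m x = distJ m y := by omega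
  rcases x with t | s | _ | _ | _ | t <;> rcases y with t' | s' | _ | _ | _ | t' <;>
    simp only [distA, distJ, cycleDist, ValidPos, ne_eq, Prod.mk.injEq, Loc.j.injEq,
      true_and] at hA hJ hp hq hpj hqj ⊢
  all_goals try simp only [Loc.a.injEq, Loc.b.injEq, reduceCtorEq]
  all_goals try omega
  · by_contra hne
    by_cases hk : k = 0
    · have := hpj (t + 1)
      have := hqj (t' + 1)
      omega
    · omega

/-- The vertex at a given position (arbitrary if the position is not valid). -/
noncomputable def vertexAt [Nonempty V] (C : LCoordinates G m n2 n3 L) : ℕ × Loc → V :=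
  Function.invFun C.pos

theorem pos_vertexAt [Nonempty V] (C : LCoordinates G m n2 n3 L) {p : ℕ × Loc}
    (hp : ValidPos m n2 n3 L p) : C.pos (C.vertexAt p) = p :=
  Function.invFun_eq (C.surj p hp)

theorem exists_isMetricGenerator (C : LCoordinates G m n2 n3 L) (hm : 2 ≤ m) (h3 : 2 ≤ n3) :
    ∃ S : Set V, S.Finite ∧ IsMetricGenerator G S ∧ S.ncard ≤ n3 := by
  have hG := C.connected hm
  have := hG.nonempty
  have hj : ∀ t, t < n3 → C.pos (C.vertexAt (0, .j t)) = (0, .j t) := fun t ht =>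
    C.pos_vertexAt ⟨by omega, by omega⟩
  have ha : C.pos (C.vertexAt (L, .a m)) = (L, .a m) := C.pos_vertexAt ⟨le_rfl, by omega⟩
  refine ⟨insert (C.vertexAt (L, .a m)) ((fun t => C.vertexAt (0, .j t)) '' Set.Iio (n3 - 1)),
    ((Set.finite_Iio _).image _).insert _, fun u v huv => ?_, ?_⟩
  · by_contra! hall
    have hleaf : ∀ t, t + 1 < n3 → C.pos u ≠ (0, .j t) ∧ C.pos v ≠ (0, .j t) := by
      intro t ht
      have h : G.dist u (C.vertexAt (0, .j t)) = G.dist v (C.vertexAt (0, .j t)) :=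
        hall _ (Set.mem_insert_of_mem _ ⟨t, by simp; omega, rfl⟩)
      refine ⟨fun hu => huv ?_, fun hv => huv ?_⟩
      · have hu := C.injective (hu.trans (hj t (by omega)).symm)
        rw [← hu, SimpleGraph.dist_self, eq_comm, hG.dist_eq_zero_iff] at h
        exact h.symm
      · have hv := C.injective (hv.trans (hj t (by omega)).symm)
        rwa [← hv, SimpleGraph.dist_self, hG.dist_eq_zero_iff] at h
    refine huv (C.injective (pos_eq_of_dist_eq hm (C.valid u) (C.valid v)
      (fun t ht => (hleaf t ht).1) (fun t ht => (hleaf t ht).2) ?_ ?_))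
    · have h := hall _ (Set.mem_insert _ _)
      rwa [(C.reachable_and_dist_lastA hm (by omega) ha u).2,
        (C.reachable_and_dist_lastA hm (by omega) ha v).2] at h
    · have h := hall _ (Set.mem_insert_of_mem _ ⟨0, by simp; omega, rfl⟩)
      rwa [C.dist_firstJ hm (hj 0 (by omega)), C.dist_firstJ hm (hj 0 (by omega))] at h
  · refine (Set.ncard_insert_le _ _).trans ?_
    have h := Set.ncard_image_le (f := fun t => C.vertexAt (0, .j t)) (Set.finite_Iio (n3 - 1))
    rw [← Finset.coe_Iio, Set.ncard_coe_finset, Nat.card_Iio] at h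
    rw [← Finset.coe_Iio]
    omega

theorem exists_linkDist (hm : 2 ≤ m) {p q : ℕ × Loc} (hp : ValidPos m n2 n3 L p)
    (hq : ValidPos m n2 n3 L q) (hl : PosLink m p q) :
    ∃ r s, LinkDist m p q r s ∧
      min (distLastA m L m p) (distLastA m L m q) + 1 = r + (L - p.1) * (m + 3) ∧
      min (distFirstJ m p) (distFirstJ m q) = s + p.1 * (m + 3) := by
  have hsame : ∀ {k x y} r s, p = (k, x) → q = (k, y) → LinkDist m p q r s →
      r = min (distA m m x) (distA m m y) + 1 → s = min (distJ m x) (distJ m y) →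
      ∃ r s, LinkDist m p q r s ∧
        min (distLastA m L m p) (distLastA m L m q) + 1 = r + (L - p.1) * (m + 3) ∧
        min (distFirstJ m p) (distFirstJ m q) = s + p.1 * (m + 3) := by
    rintro k x y r s rfl rfl hl rfl rfl
    refine ⟨_, _, hl, ?_, ?_⟩
    · rw [distLastA_mid (le_of_validPos hp), distLastA_mid (le_of_validPos hp)]
      simp only
      omega
    · simp only [distFirstJ]
      omega
  rcases hl with ⟨k, t, hp', hq'⟩ | ⟨k, hp', hq'⟩ | ⟨k, hp', hq'⟩ | ⟨k, t, hp', hq'⟩ |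
    ⟨k, hp', hq'⟩ | ⟨k, hp', hq'⟩ | ⟨k, _ | t, hp', hq'⟩ | ⟨k, hp', hq'⟩
  · have hp2 := hp' ▸ hp
    have hq2 := hq' ▸ hq
    simp only [ValidPos] at hp2 hq2
    by_cases ht : t < m
    · refine hsame (m - t) (t + 2) hp' hq' (.up k t hp' hq' ht (by omega) rfl) ?_ ?_ <;>
      simp only [distA, distJ, cycleDist] <;> omega
    · refine hsame (t + 1 - m) (2 * m + 2 - t) hp' hq'
        (.down k t hp' hq' (by omega) (by omega) (by omega)) ?_ ?_ <;>
      simp only [distA, distJ, cycleDist] <;> omega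
  · refine hsame _ _ hp' hq' (.closing k hp' hq' rfl rfl) ?_ ?_ <;>
    simp only [distA, distJ, cycleDist] <;> omega
  · refine hsame _ _ hp' hq' (.toPath k hp' hq' rfl rfl) ?_ ?_ <;>
    simp only [distA, distJ, cycleDist] <;> omega
  · have hq2 := hq' ▸ hq
    simp only [ValidPos] at hq2
    refine hsame _ _ hp' hq' (.path k t hp' hq' (by omega) rfl rfl) ?_ ?_ <;>
    simp only [distA, distJ, cycleDist] <;> omega
  · refine hsame _ _ hp' hq' (.toC k hp' hq' rfl rfl) ?_ ?_ <;>
    simp only [distA, distJ, cycleDist] <;> omega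
  · refine hsame _ _ hp' hq' (.toI k hp' hq' rfl rfl) ?_ ?_ <;>
    simp only [distA, distJ, cycleDist] <;> omega
  · refine hsame _ _ hp' hq' (.pendantZero k hp' hq' rfl rfl) ?_ ?_ <;>
    simp only [distA, distJ, cycleDist] <;> omega
  · refine hsame _ _ hp' hq' (.pendantSucc k t hp' hq' rfl rfl) ?_ ?_ <;>
    simp only [distA, distJ, cycleDist] <;> omega
  · refine ⟨_, _, .bridge k hp' hq' rfl rfl, ?_, ?_⟩ <;> subst hp' hq'
    · have h1 := distLastA_add_one_of_bridge (m := m) (t := m) (k := k) (L := L) hq.1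
      rw [distLastA_mid hp.1] at h1 ⊢
      simp only [distA, cycleDist] at h1 ⊢
      omega
    · simp only [distFirstJ, distJ, cycleDist, add_mul]
      omega

set_option maxHeartbeats 1000000 in
/-- The two distances of a link determine it, up to one ambiguous pair per copy and the
pendant links to `j_0, …, j_{n3-2}` in the first copy. -/
theorem link_eq_of_dist_eq (hm : 2 ≤ m) {p q p' q' : ℕ × Loc}
    (hp : ValidPos m n2 n3 L p) (hq : ValidPos m n2 n3 L q)
    (hp' : ValidPos m n2 n3 L p') (hq' : ValidPos m n2 n3 L q')
    (hl : PosLink m p q) (hl' : PosLink m p' q')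
    (hj : ∀ t, t + 1 < n3 → q ≠ (0, .j t)) (hj' : ∀ t, t + 1 < n3 → q' ≠ (0, .j t))
    (hA : min (distLastA m L m p) (distLastA m L m q) =
      min (distLastA m L m p') (distLastA m L m q'))
    (hJ : min (distFirstJ m p) (distFirstJ m q) = min (distFirstJ m p') (distFirstJ m q')) :
    (p = p' ∧ q = q') ∨
      ∃ k, k ≤ L ∧ ((p = (k, .a 1) ∧ p' ≠ (k, .a 1) ∧ q' ≠ (k, .a 1)) ∨
        (p' = (k, .a 1) ∧ p ≠ (k, .a 1) ∧ q ≠ (k, .a 1))) := by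
  have hkL := le_of_validPos (k := p.1) (x := p.2) hp
  have hkL' := le_of_validPos (k := p'.1) (x := p'.2) hp'
  obtain ⟨r, s, htab, hr, hs⟩ := exists_linkDist hm hp hq hl
  obtain ⟨r', s', htab', hr', hs'⟩ := exists_linkDist hm hp' hq' hl'
  have hbound : ∀ {p q r s}, ValidPos m n2 n3 L q → LinkDist m p q r s → p.1 ≠ 0 → r < m + 3 := by
    rintro p q r s hq (⟨k, t, rfl, rfl, _, _, _⟩ | ⟨k, t, rfl, rfl, _, _, _⟩ |
      ⟨k, rfl, rfl, _, _⟩ | ⟨k, rfl, rfl, _, _⟩ | ⟨k, t, rfl, rfl, _, _, _⟩ |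
      ⟨k, rfl, rfl, _, _⟩ | ⟨k, rfl, rfl, _, _⟩ | ⟨k, rfl, rfl, _, _⟩ |
      ⟨k, t, rfl, rfl, _, _⟩ | ⟨k, rfl, rfl, _, _⟩) <;>
    simp only [ValidPos] at hq ⊢ <;> omega
  have hk : p.1 = p'.1 := by
    have h := hbound hq htab
    have h' := hbound hq' htab'
    rcases lt_trichotomy p.1 p'.1 with hlt | hlt | hlt
    · have := mul_succ_le_of_lt (M := m + 3) hkL' hlt
      omega
    · exact hlt
    · have := mul_succ_le_of_lt (M := m + 3) hkL hlt
      omega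
  rw [hk] at hr hs
  obtain rfl : r = r' := by omega
  obtain rfl : s = s' := by omega
  clear hr hs hr' hs' hbound hA hJ hl hl' hp hp'
  rcases htab with ⟨k, t, rfl, rfl, _, _, _⟩ | ⟨k, t, rfl, rfl, _, _, _⟩ |
      ⟨k, rfl, rfl, _, _⟩ | ⟨k, rfl, rfl, _, _⟩ | ⟨k, t, rfl, rfl, _, _, _⟩ |
      ⟨k, rfl, rfl, _, _⟩ | ⟨k, rfl, rfl, _, _⟩ | ⟨k, rfl, rfl, _, _⟩ |
      ⟨k, t, rfl, rfl, _, _⟩ | ⟨k, rfl, rfl, _, _⟩ <;>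
  rcases htab' with ⟨k', t', rfl, rfl, _, _, _⟩ | ⟨k', t', rfl, rfl, _, _, _⟩ |
      ⟨k', rfl, rfl, _, _⟩ | ⟨k', rfl, rfl, _, _⟩ | ⟨k', t', rfl, rfl, _, _, _⟩ |
      ⟨k', rfl, rfl, _, _⟩ | ⟨k', rfl, rfl, _, _⟩ | ⟨k', rfl, rfl, _, _⟩ |
      ⟨k', t', rfl, rfl, _, _⟩ | ⟨k', rfl, rfl, _, _⟩ <;>
  simp only at hk <;> subst hk
  all_goals try (exfalso; omega)
  all_goals simp only [ValidPos] at hq hq'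
  all_goals try (left; simp; done)
  all_goals try (left; simp; omega)
  all_goals try (right; refine ⟨k, hkL, ?_⟩; simp; omega)
  have h1 := hj (t + 1)
  have h2 := hj' (t' + 1)
  simp only [ne_eq, Prod.mk.injEq, and_true] at h1 h2
  left
  simp only [Prod.mk.injEq, Loc.j.injEq, true_and]
  omega

theorem not_posLink_j {k t : ℕ} {q : ℕ × Loc} : ¬ PosLink m (k, .j t) q := by
  rintro (⟨_, _, h, _⟩ | ⟨_, h, _⟩ | ⟨_, h, _⟩ | ⟨_, _, h, _⟩ | ⟨_, h, _⟩ | ⟨_, h, _⟩ |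
    ⟨_, _, h, _⟩ | ⟨_, h, _⟩) <;> simp at h

theorem eq_of_posLink_j {t : ℕ} {p : ℕ × Loc} (h : PosLink m p (0, .j t)) : p = (0, .i) := by
  rcases h with ⟨_, _, _, h⟩ | ⟨_, _, h⟩ | ⟨_, _, h⟩ | ⟨_, _, _, h⟩ | ⟨_, _, h⟩ | ⟨_, _, h⟩ |
    ⟨_, _, hp, h⟩ | ⟨_, _, h⟩ <;> simp at h
  rw [hp, h.1]

theorem exists_posLink_of_mem_edgeSet (C : LCoordinates G m n2 n3 L) {e : Sym2 V}
    (he : e ∈ G.edgeSet) : ∃ u v, e = s(u, v) ∧ PosLink m (C.pos u) (C.pos v) := by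
  induction e with
  | h u v =>
    rcases (C.adj_iff u v).1 he with h | h
    · exact ⟨u, v, rfl, h⟩
    · exact ⟨v, u, Sym2.eq_swap, h⟩

theorem exists_isEdgeMetricGenerator (C : LCoordinates G m n2 n3 L) (hm : 2 ≤ m) (h3 : 2 ≤ n3) :
    ∃ S : Set V, S.Finite ∧ IsEdgeMetricGenerator G S ∧ S.ncard ≤ n3 + (L + 1) := by
  have hG := C.connected hm
  have := hG.nonempty
  have hj : ∀ t, t < n3 → C.pos (C.vertexAt (0, .j t)) = (0, .j t) := fun t ht =>
    C.pos_vertexAt ⟨by omega, by omega⟩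
  have ha : C.pos (C.vertexAt (L, .a m)) = (L, .a m) := C.pos_vertexAt ⟨le_rfl, by omega⟩
  have hone : ∀ k, k ≤ L → C.pos (C.vertexAt (k, .a 1)) = (k, .a 1) := fun k hk =>
    C.pos_vertexAt ⟨hk, by omega⟩
  refine ⟨insert (C.vertexAt (L, .a m)) ((fun t => C.vertexAt (0, .j t)) '' Set.Iio (n3 - 1) ∪
      (fun k => C.vertexAt (k, .a 1)) '' Set.Iio (L + 1)),
    (((Set.finite_Iio _).image _).union ((Set.finite_Iio _).image _)).insert _,
    fun e he f hf hef => ?_, ?_⟩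
  · by_contra! hall
    have hallJ : ∀ t, t + 1 < n3 →
        edgeDist G e (C.vertexAt (0, .j t)) = edgeDist G f (C.vertexAt (0, .j t)) := fun t ht =>
      hall _ (Set.mem_insert_of_mem _ (.inl ⟨t, by simp; omega, rfl⟩))
    have hallOne : ∀ k, k ≤ L → (C.vertexAt (k, .a 1) ∈ e ↔ C.vertexAt (k, .a 1) ∈ f) := by
      intro k hk
      rw [← edgeDist_eq_zero_iff hG, ← edgeDist_eq_zero_iff hG,
        hall _ (Set.mem_insert_of_mem _ (.inr ⟨k, by simp; omega, rfl⟩))]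
    obtain ⟨u, v, rfl, huv⟩ := C.exists_posLink_of_mem_edgeSet he
    obtain ⟨u', v', rfl, huv'⟩ := C.exists_posLink_of_mem_edgeSet hf
    have hleaf : ∀ {u v u' v'}, PosLink m (C.pos u) (C.pos v) → PosLink m (C.pos u') (C.pos v') →
        s(u, v) ≠ s(u', v') → ∀ t, t + 1 < n3 →
        edgeDist G s(u, v) (C.vertexAt (0, .j t)) = edgeDist G s(u', v') (C.vertexAt (0, .j t)) →
        C.pos v ≠ (0, .j t) := by
      intro u v u' v' huv huv' hne t ht heq hv
      have hvz := C.injective (hv.trans (hj t (by omega)).symm)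
      have hmem : v ∈ s(u', v') := by
        rw [← edgeDist_eq_zero_iff hG, hvz, ← heq, edgeDist_eq_zero_iff hG, hvz]
        exact Sym2.mem_mk_right _ _
      rcases Sym2.mem_iff.1 hmem with rfl | rfl
      · rw [hv] at huv'
        exact not_posLink_j huv'
      · rw [hv] at huv huv'
        rw [C.injective ((eq_of_posLink_j huv).trans (eq_of_posLink_j huv').symm)] at hne
        exact hne rfl
    have hA := hall _ (Set.mem_insert _ _)
    have hJ := hallJ 0 (by omega)
    simp only [edgeDist_mk, C.dist_firstJ hm (hj 0 (by omega)),
      fun w => (C.reachable_and_dist_lastA hm (by omega) ha w).2] at hA hJ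
    have hnot : ∀ {k u v}, k ≤ L → C.pos u ≠ (k, .a 1) → C.pos v ≠ (k, .a 1) →
        C.vertexAt (k, .a 1) ∉ s(u, v) := by
      intro k u v hk hu hv hmem
      rcases Sym2.mem_iff.1 hmem with h | h
      · exact hu (h ▸ hone k hk)
      · exact hv (h ▸ hone k hk)
    have hmem : ∀ {k u v}, k ≤ L → C.pos u = (k, .a 1) → C.vertexAt (k, .a 1) ∈ s(u, v) := by
      intro k u v hk hu
      rw [C.injective ((hone k hk).trans hu.symm)]
      exact Sym2.mem_mk_left _ _
    rcases link_eq_of_dist_eq hm (C.valid u) (C.valid v) (C.valid u') (C.valid v') huv huv'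
      (fun t ht => hleaf huv huv' hef t ht (hallJ t ht))
      (fun t ht => hleaf huv' huv hef.symm t ht (hallJ t ht).symm) hA hJ with
      ⟨hu, hv⟩ | ⟨k, hk, ⟨h1, h2, h3⟩ | ⟨h1, h2, h3⟩⟩
    · rw [C.injective hu, C.injective hv] at hef
      exact hef rfl
    · exact hnot hk h2 h3 ((hallOne k hk).1 (hmem hk h1))
    · exact hnot hk h2 h3 ((hallOne k hk).2 (hmem hk h1))
  · refine (Set.ncard_insert_le _ _).trans ?_
    have h := Set.ncard_image_le (f := fun t => C.vertexAt (0, .j t)) (Set.finite_Iio (n3 - 1))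
    have h' := Set.ncard_image_le (f := fun k => C.vertexAt (k, .a 1)) (Set.finite_Iio (L + 1))
    have hu := Set.ncard_union_le ((fun t => C.vertexAt (0, .j t)) '' Set.Iio (n3 - 1))
      ((fun k => C.vertexAt (k, .a 1)) '' Set.Iio (L + 1))
    rw [← Finset.coe_Iio, Set.ncard_coe_finset, Nat.card_Iio] at h h'
    rw [← Finset.coe_Iio, ← Finset.coe_Iio] at hu ⊢
    omega

theorem dist_eq_of_cut (C : LCoordinates G m n2 n3 L) (hm : 2 ≤ m) {P : ℕ × Loc → Prop}
    {p₀ : ℕ × Loc} (hcut : ∀ p q, PosLink m p q → (P p → ¬ P q → p = p₀) ∧ (P q → ¬ P p → q = p₀))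
    {w : V} (hw : C.pos w = p₀) {u z : V} (hu : P (C.pos u)) (hz : ¬ P (C.pos z)) :
    G.dist u z = G.dist u w + G.dist w z := by
  refine (C.connected hm).dist_eq_dist_add_dist_of_cut (A := {v | P (C.pos v)})
    (fun x y hxy hx hy => C.injective ?_) hu hz
  rw [hw]
  rcases (C.adj_iff x y).1 hxy with h | h
  · exact (hcut _ _ h).1 hx hy
  · exact (hcut _ _ h).2 hx hy

/-- The distance to a leaf of the first copy is one more than the distance to its neighbour. -/
theorem dist_leaf (C : LCoordinates G m n2 n3 L) (hm : 2 ≤ m) {t : ℕ} {u w z : V}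
    (hw : C.pos w = (0, .i)) (hz : C.pos z = (0, .j t)) (hu : u ≠ z) :
    G.dist u z = G.dist u w + 1 := by
  have hadj : G.Adj w z := (C.adj_iff w z).2 (.inl (.pendant 0 t hw hz))
  rw [C.dist_eq_of_cut hm (P := fun p => p ≠ (0, .j t)) ?_ hw
    (fun h => hu (C.injective (h.trans hz.symm))) (by simpa using hz),
    SimpleGraph.dist_eq_one_iff_adj.2 hadj]
  refine fun p q h => ⟨fun _ hq => ?_, fun _ hp => ?_⟩
  · rw [not_not] at hq
    exact eq_of_posLink_j (hq ▸ h)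
  · rw [not_not] at hp
    exact absurd (hp ▸ h) not_posLink_j

/-- Seen from the earlier copies, or from `i` and the `j_t`, core vertices of one copy are
told apart only by their distance to `j_0` in the first copy. -/
theorem dist_add_distFirstJ (C : LCoordinates G m n2 n3 L) (hm : 2 ≤ m) (h3 : 2 ≤ n3) {k : ℕ}
    {u v z : V} (hu : (C.pos u).1 = k ∧ (C.pos u).2.IsCore)
    (hv : (C.pos v).1 = k ∧ (C.pos v).2.IsCore)
    (hz : (C.pos z).1 < k ∨ (C.pos z).1 = k ∧ ¬ (C.pos z).2.IsCore) :
    G.dist u z + distFirstJ m (C.pos v) = G.dist v z + distFirstJ m (C.pos u) := by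
  have hkL : k ≤ L := hu.1 ▸ le_of_validPos (C.valid u)
  obtain ⟨w, hw⟩ := C.surj (k, .a 0) ⟨hkL, by omega⟩
  obtain ⟨o, ho⟩ := C.surj (0, .j 0) ⟨by omega, by omega⟩
  have hcut : ∀ p q : ℕ × Loc, PosLink m p q →
      ((k < p.1 ∨ p.1 = k ∧ p.2.IsCore) → ¬ (k < q.1 ∨ q.1 = k ∧ q.2.IsCore) → p = (k, .a 0)) ∧
      ((k < q.1 ∨ q.1 = k ∧ q.2.IsCore) → ¬ (k < p.1 ∨ p.1 = k ∧ p.2.IsCore) → q = (k, .a 0)) := by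
    rintro p q (⟨r, s, rfl, rfl⟩ | ⟨r, rfl, rfl⟩ | ⟨r, rfl, rfl⟩ | ⟨r, s, rfl, rfl⟩ |
      ⟨r, rfl, rfl⟩ | ⟨r, rfl, rfl⟩ | ⟨r, s, rfl, rfl⟩ | ⟨r, rfl, rfl⟩) <;>
    simp [Loc.IsCore] <;> omega
  have hz' : ∀ y, C.pos y = C.pos z ∨ C.pos y = (0, .j 0) →
      ¬ (k < (C.pos y).1 ∨ (C.pos y).1 = k ∧ (C.pos y).2.IsCore) := by
    rintro y (h | h) <;> rw [h]
    · rintro (h | h) <;> rcases hz with hz | hz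
      · omega
      · omega
      · omega
      · exact hz.2 h.2
    · simp [Loc.IsCore]
  have hcutd := fun x y hx hy => C.dist_eq_of_cut hm (u := x) (z := y)
    (P := fun p => k < p.1 ∨ p.1 = k ∧ p.2.IsCore) hcut hw hx hy
  have h1 := hcutd u z (.inr hu) (hz' z (.inl rfl))
  have h2 := hcutd v z (.inr hv) (hz' z (.inl rfl))
  have h3 := hcutd u o (.inr hu) (hz' o (.inr ho))
  have h4 := hcutd v o (.inr hv) (hz' o (.inr ho))
  rw [C.dist_firstJ hm ho] at h3 h4
  omega

/-- Seen from the later copies, vertices of one copy are told apart only by their distance to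
`a_m` in the last copy. -/
theorem dist_add_distLastA (C : LCoordinates G m n2 n3 L) (hm : 2 ≤ m) {k : ℕ}
    {u v z : V} (hu : (C.pos u).1 = k) (hv : (C.pos v).1 = k) (hz : k < (C.pos z).1) :
    G.dist u z + distLastA m L m (C.pos v) = G.dist v z + distLastA m L m (C.pos u) := by
  have hkL : k < L := hz.trans_le (le_of_validPos (C.valid z))
  obtain ⟨w, hw⟩ := C.surj (k, .a m) ⟨by omega, by omega⟩
  obtain ⟨o, ho⟩ := C.surj (L, .a m) ⟨le_rfl, by omega⟩
  have hcut : ∀ p q : ℕ × Loc, PosLink m p q →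
      (p.1 ≤ k → ¬ q.1 ≤ k → p = (k, .a m)) ∧ (q.1 ≤ k → ¬ p.1 ≤ k → q = (k, .a m)) := by
    rintro p q (⟨r, s, rfl, rfl⟩ | ⟨r, rfl, rfl⟩ | ⟨r, rfl, rfl⟩ | ⟨r, s, rfl, rfl⟩ |
      ⟨r, rfl, rfl⟩ | ⟨r, rfl, rfl⟩ | ⟨r, s, rfl, rfl⟩ | ⟨r, rfl, rfl⟩) <;>
    simp <;> omega
  have hcutd := fun x y hx hy => C.dist_eq_of_cut hm (u := x) (z := y)
    (P := fun p => p.1 ≤ k) hcut hw hx hy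
  have h1 := hcutd u z hu.le (by omega)
  have h2 := hcutd v z hv.le (by omega)
  have h3 := hcutd u o hu.le (by rw [ho]; omega)
  have h4 := hcutd v o hv.le (by rw [ho]; omega)
  rw [(C.reachable_and_dist_lastA hm (by omega) ho _).2] at h3 h4
  omega

/-- Two edges inside the core of a copy that no vertex outside this core tells apart. -/
theorem edgeDist_eq_of_not_isCore (C : LCoordinates G m n2 n3 L) (hm : 2 ≤ m) (h3 : 2 ≤ n3) {k : ℕ}
    {u v u' v' z : V} {x y x' y' : Loc} (hu : C.pos u = (k, x)) (hv : C.pos v = (k, y))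
    (hu' : C.pos u' = (k, x')) (hv' : C.pos v' = (k, y')) (hx : x.IsCore) (hy : y.IsCore)
    (hx' : x'.IsCore) (hy' : y'.IsCore)
    (hJ : min (distJ m x) (distJ m y) = min (distJ m x') (distJ m y'))
    (hA : k < L → min (distA m m x) (distA m m y) = min (distA m m x') (distA m m y'))
    (hz : ¬ ((C.pos z).1 = k ∧ (C.pos z).2.IsCore)) :
    edgeDist G s(u, v) z = edgeDist G s(u', v') z := by
  have hkL : k ≤ L := by
    have h := C.valid u
    rw [hu] at h
    exact le_of_validPos h
  simp only [edgeDist_mk]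
  by_cases hafter : k < (C.pos z).1
  · have hkL' : k < L := hafter.trans_le (le_of_validPos (C.valid z))
    have h1 := C.dist_add_distLastA hm (u := u) (v := v) (by rw [hu]) (by rw [hv]) hafter
    have h2 := C.dist_add_distLastA hm (u := u) (v := u') (by rw [hu]) (by rw [hu']) hafter
    have h3 := C.dist_add_distLastA hm (u := u) (v := v') (by rw [hu]) (by rw [hv']) hafter
    rw [hu, hv, distLastA_mid hkL, distLastA_mid hkL] at h1
    rw [hu, hu', distLastA_mid hkL, distLastA_mid hkL] at h2
    rw [hu, hv', distLastA_mid hkL, distLastA_mid hkL] at h3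
    have := hA hkL'
    omega
  · have hz' : (C.pos z).1 < k ∨ (C.pos z).1 = k ∧ ¬ (C.pos z).2.IsCore := by
      rcases lt_or_eq_of_le (not_lt.1 hafter) with h | h
      · exact .inl h
      · exact .inr ⟨h, fun hc => hz ⟨h, hc⟩⟩
    have hu0 : (C.pos u).1 = k ∧ (C.pos u).2.IsCore := by rw [hu]; exact ⟨rfl, hx⟩
    have h1 := C.dist_add_distFirstJ hm h3 (v := v) hu0 (by rw [hv]; exact ⟨rfl, hy⟩) hz'
    have h2 := C.dist_add_distFirstJ hm h3 (v := u') hu0 (by rw [hu']; exact ⟨rfl, hx'⟩) hz'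
    have h3 := C.dist_add_distFirstJ hm h3 (v := v') hu0 (by rw [hv']; exact ⟨rfl, hy'⟩) hz'
    simp only [hu, hv, hu', hv', distFirstJ] at h1 h2 h3
    omega

/-- No core vertex of the last copy tells apart all four pairs of edges. -/
theorem exists_edgeDist_eq (C : LCoordinates G m n2 n3 L) (hm : 2 ≤ m) {a₁ a₂ b a c a' z : V}
    (ha₁ : C.pos a₁ = (L, .a 1)) (ha₂ : C.pos a₂ = (L, .a 2)) (hb : C.pos b = (L, .b 0))
    (ha : C.pos a = (L, .a (2 * m))) (hc : C.pos c = (L, .c))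
    (ha' : C.pos a' = (L, .a (2 * m - 1))) (hz : (C.pos z).1 = L ∧ (C.pos z).2.IsCore) :
    edgeDist G s(b, a₁) z = edgeDist G s(a₂, a₁) z ∨ edgeDist G s(c, a) z = edgeDist G s(a, a') z ∨
      edgeDist G s(b, a₁) z = edgeDist G s(a, a') z ∨
      edgeDist G s(a₂, a₁) z = edgeDist G s(c, a) z := by
  obtain ⟨x, hx⟩ : ∃ x, C.pos z = (L, x) := ⟨_, Prod.ext hz.1 rfl⟩
  have hval := C.valid z
  rw [hx] at hz hval
  simp only [edgeDist_mk]
  rcases x with t | s | _ | _ | _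
  · simp only [ValidPos] at hval
    simp only [fun w => (C.reachable_and_dist_lastA hm hval.2 hx w).2, ha₁, ha₂, hb, ha, hc, ha',
      distLastA, if_true, distA, cycleDist]
    rcases lt_trichotomy t m with h | rfl | h
    · exact .inr (.inl (by omega))
    · exact .inr (.inr (.inl (by omega)))
    · by_cases h1 : t = m + 1
      · exact .inr (.inr (.inr (by omega)))
      · exact .inl (by omega)
  · have hcut : ∀ p q : ℕ × Loc, PosLink m p q →
        ((∀ s, p ≠ (L, .b s)) → ¬ (∀ s, q ≠ (L, .b s)) → p = (L, .a 1)) ∧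
        ((∀ s, q ≠ (L, .b s)) → ¬ (∀ s, p ≠ (L, .b s)) → q = (L, .a 1)) := by
      rintro p q (⟨r, s, rfl, rfl⟩ | ⟨r, rfl, rfl⟩ | ⟨r, rfl, rfl⟩ | ⟨r, s, rfl, rfl⟩ |
        ⟨r, rfl, rfl⟩ | ⟨r, rfl, rfl⟩ | ⟨r, s, rfl, rfl⟩ | ⟨r, rfl, rfl⟩) <;>
      simp
    have hd := fun u hu => C.dist_eq_of_cut hm (u := u) (z := z)
      (P := fun p => ∀ s, p ≠ (L, .b s)) hcut ha₁ hu (by simp [hx])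
    rw [hd a (by simp [ha]), hd c (by simp [hc]), hd a' (by simp [ha'])]
    simp only [fun w => (C.reachable_and_dist_lastA hm (t := 1) (by omega) ha₁ w).2, ha, hc, ha',
      distLastA, if_true, distA, cycleDist]
    omega
  · have hcut : ∀ p q : ℕ × Loc, PosLink m p q →
        (p ≠ (L, .c) → ¬ q ≠ (L, .c) → p = (L, .a (2 * m))) ∧
        (q ≠ (L, .c) → ¬ p ≠ (L, .c) → q = (L, .a (2 * m))) := by
      rintro p q (⟨r, s, rfl, rfl⟩ | ⟨r, rfl, rfl⟩ | ⟨r, rfl, rfl⟩ | ⟨r, s, rfl, rfl⟩ |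
        ⟨r, rfl, rfl⟩ | ⟨r, rfl, rfl⟩ | ⟨r, s, rfl, rfl⟩ | ⟨r, rfl, rfl⟩) <;>
      simp
    have hd := fun u hu => C.dist_eq_of_cut hm (u := u) (z := z)
      (P := fun p => p ≠ (L, .c)) hcut ha hu (by simp [hx])
    rw [hd a₁ (by simp [ha₁]), hd a₂ (by simp [ha₂]), hd b (by simp [hb])]
    simp only [fun w => (C.reachable_and_dist_lastA hm (t := 2 * m) le_rfl ha w).2, ha₁, ha₂, hb,
      distLastA, if_true, distA, cycleDist]
    omega
  · exact hz.2.elim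
  · exact hz.2.elim

/-- A set meeting every pair of leaves of the first copy misses at most one of them. -/
theorem le_ncard_leaves (C : LCoordinates G m n2 n3 L) {S : Set V} (hfin : S.Finite)
    (hS : ∀ u v s t, C.pos u = (0, .j s) → C.pos v = (0, .j t) → u ≠ v → u ∈ S ∨ v ∈ S) :
    n3 ≤ (S ∩ {v | ∃ t, C.pos v = (0, .j t)}).ncard + 1 := by
  rcases Nat.eq_zero_or_pos n3 with rfl | h3
  · exact Nat.zero_le _
  obtain ⟨v₀, hv₀⟩ := C.surj (0, .j 0) ⟨by omega, by omega⟩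
  have : Nonempty V := ⟨v₀⟩
  have hpos : ∀ t, t < n3 → C.pos (C.vertexAt (0, .j t)) = (0, .j t) := fun t ht =>
    C.pos_vertexAt ⟨by omega, by omega⟩
  have hinj : ∀ s t, s < n3 → t < n3 → C.vertexAt (0, .j s) = C.vertexAt (0, .j t) → s = t := by
    intro s t hs ht h
    have h := congrArg C.pos h
    rw [hpos s hs, hpos t ht] at h
    simpa using h
  obtain ⟨t₀, ht₀, hmem⟩ : ∃ t₀ < n3, ∀ t < n3, t ≠ t₀ → C.vertexAt (0, .j t) ∈ S := by
    by_cases hall : ∀ t < n3, C.vertexAt (0, .j t) ∈ S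
    · exact ⟨0, h3, fun t ht _ => hall t ht⟩
    · push Not at hall
      obtain ⟨t₀, ht₀, hnot⟩ := hall
      exact ⟨t₀, ht₀, fun t ht hne => (hS _ _ t t₀ (hpos t ht) (hpos t₀ ht₀)
        fun h => hne (hinj t t₀ ht ht₀ h)).resolve_right hnot⟩
  have hsub : (fun t => C.vertexAt (0, .j t)) '' ((Finset.range n3).erase t₀ : Finset ℕ) ⊆
      S ∩ {v | ∃ t, C.pos v = (0, .j t)} := by
    rintro _ ⟨t, ht, rfl⟩
    simp only [Finset.coe_erase, Finset.coe_range, Set.mem_sdiff, Set.mem_Iio,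
      Set.mem_singleton_iff] at ht
    exact ⟨hmem t ht.1 ht.2, t, hpos t ht.1⟩
  have hcard := Set.ncard_le_ncard hsub (hfin.inter_of_left _)
  rw [Set.InjOn.ncard_image, Set.ncard_coe_finset,
    Finset.card_erase_of_mem (Finset.mem_range.2 ht₀), Finset.card_range] at hcard
  · omega
  · intro s hs t ht h
    simp only [Finset.coe_erase, Finset.coe_range, Set.mem_sdiff, Set.mem_Iio,
      Set.mem_singleton_iff] at hs ht
    exact hinj s t hs.1 ht.1 h

/-- Two leaves of the first copy have the same distance to every other vertex. -/
theorem dist_leaf_eq_dist_leaf (C : LCoordinates G m n2 n3 L) (hm : 2 ≤ m) {u v z : V} {s t : ℕ}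
    (hu : C.pos u = (0, .j s)) (hv : C.pos v = (0, .j t)) (hzu : z ≠ u) (hzv : z ≠ v) :
    G.dist u z = G.dist v z := by
  obtain ⟨w, hw⟩ := C.surj (0, .i) (Nat.zero_le L)
  rw [G.dist_comm, G.dist_comm (u := v), C.dist_leaf hm hw hu hzu, C.dist_leaf hm hw hv hzv]

theorem le_ncard_of_isMetricGenerator (C : LCoordinates G m n2 n3 L) (hm : 2 ≤ m) (h3 : 2 ≤ n3)
    {S : Set V} (hfin : S.Finite) (hS : IsMetricGenerator G S) : n3 ≤ S.ncard := by
  have hleaves := C.le_ncard_leaves hfin fun u v s t hu hv huv => by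
    by_contra! hnot
    obtain ⟨z, hz, hne⟩ := hS u v huv
    exact hne (C.dist_leaf_eq_dist_leaf hm hu hv (fun h => hnot.1 (h ▸ hz))
      fun h => hnot.2 (h ▸ hz))
  obtain ⟨x, hx⟩ := C.surj (0, .a 1) ⟨by omega, by omega⟩
  obtain ⟨y, hy⟩ := C.surj (0, .a (2 * m)) ⟨by omega, by omega⟩
  obtain ⟨w, hw⟩ := C.surj (0, .i) (Nat.zero_le L)
  obtain ⟨o, ho⟩ := C.surj (0, .j 0) ⟨by omega, by omega⟩
  obtain ⟨z, hzS, hz⟩ := hS x y fun h => by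
    rw [h, hy] at hx
    simp at hx
  have hzJ : z ∉ {v | ∃ t, C.pos v = (0, .j t)} := by
    rintro ⟨t, ht⟩
    have hxw := C.dist_leaf hm hw ho (u := x) (by rintro rfl; simp [hx] at ho)
    have hyw := C.dist_leaf hm hw ho (u := y) (by rintro rfl; simp [hy] at ho)
    rw [C.dist_firstJ hm ho, hx] at hxw
    rw [C.dist_firstJ hm ho, hy] at hyw
    rw [C.dist_leaf hm hw ht (by rintro rfl; simp [hx] at ht),
      C.dist_leaf hm hw ht (by rintro rfl; simp [hy] at ht)] at hz
    simp only [distFirstJ, distJ, cycleDist] at hxw hyw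
    omega
  have hpos : 0 < (S \ {v | ∃ t, C.pos v = (0, .j t)}).ncard :=
    (Set.ncard_pos hfin.sdiff).2 ⟨z, hzS, hzJ⟩
  have := Set.ncard_inter_add_ncard_sdiff_eq_ncard S {v | ∃ t, C.pos v = (0, .j t)} hfin
  omega

/-- An edge metric generator has to contain a core vertex telling apart two core edges of a copy
that look the same from outside. -/
theorem exists_isCore_edgeDist_ne (C : LCoordinates G m n2 n3 L) (hm : 2 ≤ m) (h3 : 2 ≤ n3)
    {S : Set V} (hS : IsEdgeMetricGenerator G S) {k : ℕ}
    {u v u' v' : V} {x y x' y' : Loc} (hu : C.pos u = (k, x)) (hv : C.pos v = (k, y))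
    (hu' : C.pos u' = (k, x')) (hv' : C.pos v' = (k, y')) (hx : x.IsCore) (hy : y.IsCore)
    (hx' : x'.IsCore) (hy' : y'.IsCore) (huv : G.Adj u v) (huv' : G.Adj u' v')
    (hxx' : x ≠ x') (hxy' : x ≠ y')
    (hJ : min (distJ m x) (distJ m y) = min (distJ m x') (distJ m y'))
    (hA : k < L → min (distA m m x) (distA m m y) = min (distA m m x') (distA m m y')) :
    ∃ z ∈ S, ((C.pos z).1 = k ∧ (C.pos z).2.IsCore) ∧
      edgeDist G s(u, v) z ≠ edgeDist G s(u', v') z := by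
  obtain ⟨z, hz, hne⟩ := hS s(u, v) huv s(u', v') huv' fun h => by
    have hmem : u ∈ s(u', v') := h ▸ Sym2.mem_mk_left u v
    rcases Sym2.mem_iff.1 hmem with rfl | rfl
    · rw [hu] at hu'
      exact hxx' (congrArg Prod.snd hu')
    · rw [hu] at hv'
      exact hxy' (congrArg Prod.snd hv')
  refine ⟨z, hz, ?_, hne⟩
  by_contra hcore
  exact hne (C.edgeDist_eq_of_not_isCore hm h3 hu hv hu' hv' hx hy hx' hy' hJ hA hcore)

/-- An edge metric generator contains a core vertex of each copy, and two of the last copy. -/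
theorem le_ncard_core (C : LCoordinates G m n2 n3 L) (hm : 2 ≤ m) (h2 : 1 ≤ n2) (h3 : 2 ≤ n3)
    {S : Set V} (hfin : S.Finite) (hS : IsEdgeMetricGenerator G S) :
    L + 2 ≤ (S \ {v | ∃ t, C.pos v = (0, .j t)}).ncard := by
  have hG := C.connected hm
  have := hG.nonempty
  have ha : ∀ k t, k ≤ L → t ≤ 2 * m → C.pos (C.vertexAt (k, .a t)) = (k, .a t) :=
    fun k t hk ht => C.pos_vertexAt ⟨hk, ht⟩
  have hb : ∀ k, k ≤ L → C.pos (C.vertexAt (k, .b 0)) = (k, .b 0) :=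
    fun k hk => C.pos_vertexAt ⟨hk, by omega⟩
  have hc : C.pos (C.vertexAt (L, .c)) = (L, .c) := C.pos_vertexAt (p := (L, .c)) le_rfl
  have hadj : ∀ {u v p q}, C.pos u = p → C.pos v = q → PosLink m p q → G.Adj u v ∧ G.Adj v u :=
    fun hu hv h => have h := (C.adj_iff _ _).2 (.inl (hu.symm ▸ hv.symm ▸ h)); ⟨h, h.symm⟩
  have hba : ∀ k, k ≤ L → G.Adj (C.vertexAt (k, .b 0)) (C.vertexAt (k, .a 1)) := fun k hk =>
    (hadj (ha k 1 hk (by omega)) (hb k hk) (.toPath k rfl rfl)).2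
  have haa : ∀ k, k ≤ L → G.Adj (C.vertexAt (k, .a (2 * m))) (C.vertexAt (k, .a (2 * m - 1))) :=
    fun k hk => (hadj (ha k (2 * m - 1) hk (by omega)) (ha k (2 * m) hk le_rfl)
      (.cycle k (2 * m - 1) rfl (by rw [Nat.sub_add_cancel (by omega)]))).2
  have hcopy : ∀ k, k ≤ L → ∃ z ∈ S, ((C.pos z).1 = k ∧ (C.pos z).2.IsCore) ∧
      edgeDist G s(C.vertexAt (k, .b 0), C.vertexAt (k, .a 1)) z ≠
        edgeDist G s(C.vertexAt (k, .a (2 * m)), C.vertexAt (k, .a (2 * m - 1))) z := by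
    intro k hk
    refine C.exists_isCore_edgeDist_ne hm h3 hS (hb k hk) (ha k 1 hk (by omega))
      (ha k (2 * m) hk le_rfl) (ha k (2 * m - 1) hk (by omega)) trivial trivial trivial trivial
      (hba k hk) (haa k hk) (by simp) (by simp) ?_ fun _ => ?_
    · simp only [distJ, cycleDist]; omega
    · simp only [distA, cycleDist]; omega
  have hlast : ∃ z ∈ S, ∃ z' ∈ S, ((C.pos z).1 = L ∧ (C.pos z).2.IsCore) ∧
      ((C.pos z').1 = L ∧ (C.pos z').2.IsCore) ∧ z ≠ z' := by
    by_contra! hnot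
    obtain ⟨z, hz, hzcore, h34⟩ := hcopy L le_rfl
    have hone := ha L 1 le_rfl (by omega)
    have htwo := ha L 2 le_rfl (by omega)
    have hend := ha L (2 * m) le_rfl le_rfl
    have hprev := ha L (2 * m - 1) le_rfl (by omega)
    have haa₂ := (hadj hone htwo (.cycle L 1 rfl rfl)).2
    have hca := (hadj hend hc (.toC L rfl rfl)).2
    obtain ⟨z₁, hz₁, hcore₁, h₁⟩ := C.exists_isCore_edgeDist_ne hm h3 hS (hb L le_rfl) hone htwo
      hone trivial trivial trivial trivial (hba L le_rfl) haa₂ (by simp) (by simp)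
      (by simp only [distJ, cycleDist]; omega) (fun h => absurd h (lt_irrefl L))
    obtain ⟨z₂, hz₂, hcore₂, h₂⟩ := C.exists_isCore_edgeDist_ne hm h3 hS hc hend hend hprev
      trivial trivial trivial trivial hca (haa L le_rfl) (by simp) (by simp)
      (by simp only [distJ, cycleDist]; omega) (fun h => absurd h (lt_irrefl L))
    obtain ⟨z₃, hz₃, hcore₃, h₃⟩ := C.exists_isCore_edgeDist_ne hm h3 hS htwo hone hc hend
      trivial trivial trivial trivial haa₂ hca (by simp) (by simp; omega)
      (by simp only [distJ, cycleDist]; omega) (fun h => absurd h (lt_irrefl L))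
    obtain rfl := hnot z hz z₁ hz₁ hzcore hcore₁
    obtain rfl := hnot z hz z₂ hz₂ hzcore hcore₂
    obtain rfl := hnot z hz z₃ hz₃ hzcore hcore₃
    rcases C.exists_edgeDist_eq hm hone htwo (hb L le_rfl) hend hc hprev hzcore with h | h | h | h
    · exact h₁ h
    · exact h₂ h
    · exact h34 h
    · exact h₃ h
  have hchoice : ∀ k, ∃ z, k ≤ L → z ∈ S ∧ (C.pos z).1 = k ∧ (C.pos z).2.IsCore := by
    intro k
    by_cases hk : k ≤ L
    · obtain ⟨z, hz, hcore, -⟩ := hcopy k hk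
      exact ⟨z, fun _ => ⟨hz, hcore⟩⟩
    · exact ⟨Classical.arbitrary V, fun h => absurd h hk⟩
  choose f hf using hchoice
  obtain ⟨w, hwS, hwcore, hwne⟩ : ∃ w ∈ S, ((C.pos w).1 = L ∧ (C.pos w).2.IsCore) ∧ w ≠ f L := by
    obtain ⟨z, hz, z', hz', hcore, hcore', hne⟩ := hlast
    by_cases h : z = f L
    · exact ⟨z', hz', hcore', fun h' => hne (h.trans h'.symm)⟩
    · exact ⟨z, hz, hcore, h⟩
  have hnotJ : ∀ v, (C.pos v).2.IsCore → v ∉ {v | ∃ t, C.pos v = (0, .j t)} := by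
    rintro v hv ⟨t, ht⟩
    rw [ht] at hv
    exact hv
  have hwnot : w ∉ f '' (Finset.range (L + 1) : Set ℕ) := by
    rintro ⟨k, hk, rfl⟩
    have hk : k ≤ L := by simpa [Nat.lt_succ_iff] using hk
    exact hwne (by rw [← (hf k hk).2.1, hwcore.1])
  have hsub : insert w (f '' (Finset.range (L + 1) : Set ℕ)) ⊆
      S \ {v | ∃ t, C.pos v = (0, .j t)} := by
    rintro v (rfl | ⟨k, hk, rfl⟩)
    · exact ⟨hwS, hnotJ _ hwcore.2⟩
    · have hk : k ≤ L := by simpa [Nat.lt_succ_iff] using hk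
      exact ⟨(hf k hk).1, hnotJ _ (hf k hk).2.2⟩
  have hcard := Set.ncard_le_ncard hsub hfin.sdiff
  rw [Set.ncard_insert_of_notMem hwnot ((Finset.finite_toSet _).image _),
    Set.InjOn.ncard_image, Set.ncard_coe_finset, Finset.card_range] at hcard
  · exact hcard
  · intro k hk k' hk' h
    simp only [Finset.coe_range, Set.mem_Iio, Nat.lt_succ_iff] at hk hk'
    rw [← (hf k hk).2.1, ← (hf k' hk').2.1, h]

theorem le_ncard_of_isEdgeMetricGenerator (C : LCoordinates G m n2 n3 L) (hm : 2 ≤ m)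
    (h2 : 1 ≤ n2) (h3 : 2 ≤ n3) {S : Set V} (hfin : S.Finite) (hS : IsEdgeMetricGenerator G S) :
    n3 + (L + 1) ≤ S.ncard := by
  have hleaves := C.le_ncard_leaves hfin fun u v s t hu hv huv => by
    by_contra! hnot
    obtain ⟨w, hw⟩ := C.surj (0, .i) (Nat.zero_le L)
    obtain ⟨z, hz, hne⟩ := hS s(w, u) ((C.adj_iff _ _).2 (.inl (.pendant 0 s hw hu))) s(w, v)
      ((C.adj_iff _ _).2 (.inl (.pendant 0 t hw hv))) fun h => huv (Sym2.congr_right.1 h)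
    rw [edgeDist_mk, edgeDist_mk, C.dist_leaf_eq_dist_leaf hm hu hv (fun h => hnot.1 (h ▸ hz))
      fun h => hnot.2 (h ▸ hz)] at hne
    exact hne rfl
  have := C.le_ncard_core hm h2 h3 hfin hS
  have := Set.ncard_inter_add_ncard_sdiff_eq_ncard S {v | ∃ t, C.pos v = (0, .j t)} hfin
  omega

end LCoordinates

/-- The place of a vertex of `G_{n1,n2,n3}`. -/
def GVert.loc {n1 n2 n3 : ℕ} : GVert n1 n2 n3 → Loc
  | .a k => .a k
  | .b s => .b s
  | .c => .c
  | .i => .i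
  | .j t => .j t

theorem GVert.loc_injective {n1 n2 n3 : ℕ} :
    Function.Injective (GVert.loc : GVert n1 n2 n3 → Loc) := by
  rintro (x | x | _ | _ | x) (y | y | _ | _ | y) h <;> simp [GVert.loc, Fin.val_inj] at h ⊢ <;>
    exact h

theorem gRel_iff_posLink {m n2 n3 k : ℕ} (x y : GVert (2 * m + 1) n2 n3) :
    GRel (2 * m + 1) n2 n3 x y ↔ PosLink m (k, x.loc) (k, y.loc) := by
  constructor
  · intro h
    rcases x with x | x | _ | _ | x <;> rcases y with y | y | _ | _ | y <;>
      simp only [GRel] at h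
    · by_cases hx : (x : ℕ) = 2 * m
      · rw [hx, Nat.mod_self] at h
        exact .closing k (by simp [GVert.loc, hx]) (by simp [GVert.loc, h])
      · rw [Nat.mod_eq_of_lt (by omega)] at h
        exact .cycle k x rfl (by simp [GVert.loc, h])
    · exact .toPath k (by simp [GVert.loc, h]) (by simp [GVert.loc, h])
    · exact .toC k (by simp [GVert.loc, h]) rfl
    · exact .toI k (by simp [GVert.loc, h]) rfl
    · exact .path k x rfl (by simp [GVert.loc, h])
    · exact .pendant k y rfl rfl
  · rcases x with x | x | _ | _ | x <;> rcases y with y | y | _ | _ | y <;>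
      rintro (⟨r, s, hp, hq⟩ | ⟨r, hp, hq⟩ | ⟨r, hp, hq⟩ | ⟨r, s, hp, hq⟩ | ⟨r, hp, hq⟩ |
        ⟨r, hp, hq⟩ | ⟨r, s, hp, hq⟩ | ⟨r, hp, hq⟩) <;>
      simp only [GVert.loc, Prod.mk.injEq, Loc.a.injEq, Loc.b.injEq, reduceCtorEq,
        and_false] at hp hq <;>
      simp only [GRel]
    · rw [Nat.mod_eq_of_lt (by omega)]
      omega
    · rw [hp.2, Nat.mod_self]
      exact hq.2
    all_goals omega

theorem PosLink.ne {m : ℕ} {p q : ℕ × Loc} (hm : 1 ≤ m) (h : PosLink m p q) : p ≠ q := by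
  rcases h with ⟨k, t, rfl, rfl⟩ | ⟨k, rfl, rfl⟩ | ⟨k, rfl, rfl⟩ | ⟨k, s, rfl, rfl⟩ |
    ⟨k, rfl, rfl⟩ | ⟨k, rfl, rfl⟩ | ⟨k, t, rfl, rfl⟩ | ⟨k, rfl, rfl⟩ <;> simp
  omega

theorem PosLink.of_fst_ne {m k k' : ℕ} {x y : Loc} (h : PosLink m (k, x) (k', y)) (hk : k ≠ k') :
    k' = k + 1 ∧ x = .a m ∧ y = .j 0 := by
  rcases h with ⟨r, s, hp, hq⟩ | ⟨r, hp, hq⟩ | ⟨r, hp, hq⟩ | ⟨r, s, hp, hq⟩ | ⟨r, hp, hq⟩ |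
    ⟨r, hp, hq⟩ | ⟨r, s, hp, hq⟩ | ⟨r, hp, hq⟩ <;> rw [Prod.mk.injEq] at hp hq
  case bridge => exact ⟨by omega, hp.2, hq.2⟩
  all_goals omega

theorem gGraph_adj_iff_posLink {m n2 n3 k : ℕ} (hm : 1 ≤ m) (x y : GVert (2 * m + 1) n2 n3) :
    (GGraph (2 * m + 1) n2 n3).Adj x y ↔
      PosLink m (k, x.loc) (k, y.loc) ∨ PosLink m (k, y.loc) (k, x.loc) := by
  rw [GGraph, SimpleGraph.fromRel_adj, gRel_iff_posLink (k := k), gRel_iff_posLink (k := k)]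
  refine and_iff_right_of_imp ?_
  rintro (h | h) rfl <;> exact h.ne hm rfl

theorem isAlphaVert_iff {m n2 n3 : ℕ} (x : GVert (2 * m + 1) n2 n3) :
    IsAlphaVert x ↔ x.loc = .a m := by
  rcases x with x | x | _ | _ | x <;> simp [IsAlphaVert, GVert.loc]
  omega

theorem isJOneVert_iff {n1 n2 n3 : ℕ} (x : GVert n1 n2 n3) : IsJOneVert x ↔ x.loc = .j 0 := by
  rcases x with x | x | _ | _ | x <;> simp [IsJOneVert, GVert.loc]

/-- The position of a vertex of `L^ℓ_{n1,n2,n3}`. -/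
def LVert.pos {n1 n2 n3 ℓ : ℕ} : LVert n1 n2 n3 ℓ → ℕ × Loc
  | .inl x => (0, x.loc)
  | .inr (k, x) => (k + 1, x.loc)

theorem posLink_of_lRel {m n2 n3 ℓ : ℕ} (hm : 1 ≤ m) (u v : LVert (2 * m + 1) n2 n3 ℓ)
    (h : LRel (2 * m + 1) n2 n3 ℓ u v) :
    PosLink m (LVert.pos u) (LVert.pos v) ∨ PosLink m (LVert.pos v) (LVert.pos u) := by
  rcases u with x | ⟨k, x⟩ <;> rcases v with y | ⟨k', y⟩ <;> simp only [LRel] at h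
  · exact (gGraph_adj_iff_posLink hm x y).1 h
  · rw [isAlphaVert_iff, isJOneVert_iff] at h
    exact .inl (.bridge 0 (by simp [LVert.pos, h]) (by simp [LVert.pos, h]))
  · rw [isAlphaVert_iff, isJOneVert_iff] at h
    rcases h with ⟨rfl, h⟩ | h
    · exact (gGraph_adj_iff_posLink hm x y).1 h
    · exact .inl (.bridge (k + 1) (by simp [LVert.pos, h]) (by simp [LVert.pos, h]))

theorem lRel_of_posLink {m n2 n3 ℓ : ℕ} (hm : 1 ≤ m) (u v : LVert (2 * m + 1) n2 n3 ℓ)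
    (h : PosLink m (LVert.pos u) (LVert.pos v)) : LRel (2 * m + 1) n2 n3 ℓ u v := by
  rcases u with x | ⟨k, x⟩ <;> rcases v with y | ⟨k', y⟩ <;> simp only [LRel] <;>
    simp only [LVert.pos] at h
  · exact (gGraph_adj_iff_posLink hm x y).2 (.inl h)
  · rw [isAlphaVert_iff, isJOneVert_iff]
    have h := h.of_fst_ne (by omega)
    exact ⟨by omega, h.2⟩
  · have h := h.of_fst_ne (by omega)
    omega
  · rw [isAlphaVert_iff, isJOneVert_iff]
    by_cases hk : k = k'
    · subst hk
      exact .inl ⟨rfl, (gGraph_adj_iff_posLink hm x y).2 (.inl h)⟩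
    · have h := h.of_fst_ne (by omega)
      exact .inr ⟨by omega, h.2⟩

theorem GVert.exists_loc_eq {m n2 n3 L k : ℕ} {x : Loc} (hx : ValidPos m n2 n3 L (k, x)) :
    (k = 0 → ∃ y : GVert (2 * m + 1) n2 n3, y.loc = x) ∧
      (k ≠ 0 → ∃ y : GVert (2 * m + 1) 1 2, y.loc = x) := by
  cases x with
  | a t =>
    simp only [ValidPos] at hx
    exact ⟨fun _ => ⟨.a ⟨t, by omega⟩, rfl⟩, fun _ => ⟨.a ⟨t, by omega⟩, rfl⟩⟩
  | b s =>
    simp only [ValidPos] at hx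
    exact ⟨fun _ => ⟨.b ⟨s, by omega⟩, rfl⟩, fun _ => ⟨.b ⟨s, by omega⟩, rfl⟩⟩
  | c => exact ⟨fun _ => ⟨.c, rfl⟩, fun _ => ⟨.c, rfl⟩⟩
  | i => exact ⟨fun _ => ⟨.i, rfl⟩, fun _ => ⟨.i, rfl⟩⟩
  | j t =>
    simp only [ValidPos] at hx
    exact ⟨fun _ => ⟨.j ⟨t, by omega⟩, rfl⟩, fun _ => ⟨.j ⟨t, by omega⟩, rfl⟩⟩

/-- The coordinates of `L^{L+1}_{2m+1,n2,n3}`. -/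
def lGraphCoordinates {m : ℕ} (n2 n3 L : ℕ) (hm : 1 ≤ m) :
    LCoordinates (LGraph (2 * m + 1) n2 n3 (L + 1)) m n2 n3 L where
  pos := LVert.pos
  injective := by
    rintro (x | ⟨k, x⟩) (y | ⟨k', y⟩) h <;> simp only [LVert.pos, Prod.mk.injEq] at h
    · rw [GVert.loc_injective h.2]
    · omega
    · omega
    · rw [GVert.loc_injective h.2, Fin.ext (Nat.succ_injective h.1)]
  valid := by
    rintro (x | ⟨k, x⟩)
    · rcases x with x | x | _ | _ | x <;> simp [LVert.pos, GVert.loc, ValidPos]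
      omega
    · have hk : (k : ℕ) < L := k.2
      rcases x with x | x | _ | _ | x <;> simp [LVert.pos, GVert.loc, ValidPos] <;> omega
  surj := by
    rintro ⟨k, x⟩ hx
    have hk : k ≤ L := LCoordinates.le_of_validPos hx
    cases k with
    | zero =>
      obtain ⟨y, rfl⟩ := (GVert.exists_loc_eq hx).1 rfl
      exact ⟨.inl y, rfl⟩
    | succ k =>
      obtain ⟨y, rfl⟩ := (GVert.exists_loc_eq hx).2 (Nat.succ_ne_zero k)
      exact ⟨.inr (⟨k, hk⟩, y), rfl⟩
  adj_iff u v := by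
    rw [LGraph, SimpleGraph.fromRel_adj]
    constructor
    · rintro ⟨-, h | h⟩
      · exact posLink_of_lRel hm u v h
      · exact (posLink_of_lRel hm v u h).symm
    · rintro (h | h)
      · exact ⟨fun huv => h.ne hm (congrArg _ huv), .inl (lRel_of_posLink hm u v h)⟩
      · exact ⟨fun huv => h.ne hm (congrArg _ huv.symm), .inr (lRel_of_posLink hm v u h)⟩

/-- Lemma 6 (odd case): if `n1` is odd then `dim(L^ℓ_{n1,n2,n3}) = n3` and
`edim(L^ℓ_{n1,n2,n3}) = n3 + ℓ`. -/
theorem LGraph_odd (n1 n2 n3 ℓ : ℕ) (h1 : 5 ≤ n1) (hodd : Odd n1)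
    (h2 : 1 ≤ n2) (h3 : 2 ≤ n3) (hl : 1 ≤ ℓ) :
    metricDim (LGraph n1 n2 n3 ℓ) = n3 ∧
    edgeMetricDim (LGraph n1 n2 n3 ℓ) = n3 + ℓ := by
  obtain ⟨m, rfl⟩ := hodd
  obtain ⟨L, rfl⟩ := Nat.exists_eq_add_of_le' hl
  have hm : 2 ≤ m := by omega
  have C := lGraphCoordinates n2 n3 L (one_le_two.trans hm)
  exact ⟨metricDim_eq_of_forall_le (C.exists_isMetricGenerator hm h3)
      fun S hfin hS => C.le_ncard_of_isMetricGenerator hm h3 hfin hS,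
    edgeMetricDim_eq_of_forall_le (C.exists_isEdgeMetricGenerator hm h3)
      fun S hfin hS => C.le_ncard_of_isEdgeMetricGenerator hm h2 h3 hfin hS⟩
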